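/- (Bounding Lemma, LTL\X, disjunctive, fair.) For disjunctive systems with process templates A,B, G = G_A ∪ G_B, and n ≥ |B| + |G| + 1: if some unconditionally-fair run of (A,B)^(1,n) satisfies the 1-indexed LTL\X formula h(A,B^(1)), then some unconditionally-fair run of (A,B)^(1,|B|+|G|+1) satisfies h(A,B^(1)). -/

import Mathlib

namespace GP

/-- A process template: an initial state and a guarded transition relation.
`Gd` is the type of guards. -/
structure Template (Q Sig Gd : Type) where
  init : Q
  trans : Set (Q × Sig × Gd × Q)

variable {QA QB SA SB Gd : Type}

/-- Processes of `(A,B)^{(1,n)}`: `none` is the `A`-process, `some i` is `B_i`. -/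
abbrev Proc (n : ℕ) := Option (Fin n)
/-- A global state. -/
abbrev GState (QA QB : Type) (n : ℕ) := QA × (Fin n → QB)
/-- A global input. -/
abbrev GInput (SA SB : Type) (n : ℕ) := SA × (Fin n → SB)

/-- The local state of process `p` in global state `s`. -/
def view {n : ℕ} (s : GState QA QB n) : Proc n → QA ⊕ QB
  | none => Sum.inl s.1
  | some i => Sum.inr (s.2 i)

/-- The local input of process `p` in global input `e`. -/
def inp {n : ℕ} (e : GInput SA SB n) : Proc n → SA ⊕ SB
  | none => Sum.inl e.1
  | some i => Sum.inr (e.2 i)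

/-- The set of local states of the processes other than `p`. -/
def others {n : ℕ} (s : GState QA QB n) (p : Proc n) : Set (QA ⊕ QB) :=
  {x | ∃ p', p' ≠ p ∧ view s p' = x}

/-- Disjunctive interpretation of guards: some other process is in the guard. -/
def disjSat (S : Set (QA ⊕ QB)) (g : Set (QA ⊕ QB)) : Prop := ∃ x ∈ S, x ∈ g
/-- Conjunctive interpretation of guards: every other process is in the guard. -/
def conjSat (S : Set (QA ⊕ QB)) (g : Set (QA ⊕ QB)) : Prop := ∀ x ∈ S, x ∈ g
/-- Conjunction-of-disjunctive-guards interpretation: a guard is a finite set of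
disjunctive conjuncts, each of which must be witnessed by some other process. -/
def cdSat (S : Set (QA ⊕ QB)) (g : Set (Set (QA ⊕ QB))) : Prop := ∀ D ∈ g, ∃ x ∈ S, x ∈ D

section System

variable (A : Template QA SA Gd) (B : Template QB SB Gd)
variable (sat : Set (QA ⊕ QB) → Gd → Prop)

/-- Process `p` is enabled for global state `s` and input `e`. -/
def enabled {n : ℕ} (s : GState QA QB n) (e : GInput SA SB n) : Proc n → Prop
  | none => ∃ g q', (s.1, e.1, g, q') ∈ A.trans ∧ sat (others s none) g
  | some i => ∃ g q', (s.2 i, e.2 i, g, q') ∈ B.trans ∧ sat (others s (some i)) g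

/-- One interleaving step of the system, performed by process `p`. -/
def step {n : ℕ} (s : GState QA QB n) (e : GInput SA SB n) : Proc n → GState QA QB n → Prop
  | none, s' => ∃ g q', (s.1, e.1, g, q') ∈ A.trans ∧ sat (others s none) g ∧ s' = (q', s.2)
  | some i, s' => ∃ g q', (s.2 i, e.2 i, g, q') ∈ B.trans ∧ sat (others s (some i)) g ∧
      s' = (s.1, Function.update s.2 i q')

/-- The global initial state. -/
def isInit {n : ℕ} (s : GState QA QB n) : Prop := s.1 = A.init ∧ ∀ i, s.2 i = B.init

/-- An infinite run of `(A,B)^{(1,n)}`: at each moment `t` process `mv t` makes a step,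
and the input of a process stays unchanged until that process moves. -/
structure Run (n : ℕ) where
  s : ℕ → GState QA QB n
  e : ℕ → GInput SA SB n
  mv : ℕ → Proc n
  isInit0 : isInit A B (s 0)
  steps : ∀ t, step A B sat (s t) (e t) (mv t) (s (t + 1))
  persist : ∀ t p, p ≠ mv t → inp (e (t + 1)) p = inp (e t) p

/-- The run `x` is locally deadlocked for process `p`. -/
def lockedFrom {n : ℕ} (x : Run A B sat n) (p : Proc n) : Prop :=
  ∃ t0, ∀ t ≥ t0, ¬ enabled A B sat (x.s t) (x.e t) p

/-- The run `x` is locally deadlocked for the `B`-process `i`, which is stuck in state `q`. -/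
def lockedInState {n : ℕ} (x : Run A B sat n) (i : Fin n) (q : QB) : Prop :=
  ∃ t0, ∀ t ≥ t0, ¬ enabled A B sat (x.s t) (x.e t) (some i) ∧ (x.s t).2 i = q

/-- `(A,B)^{(1,n)}` has a local deadlock. -/
def hasLocalDeadlock (n : ℕ) : Prop :=
  ∃ x : Run A B sat n, ∃ p, lockedFrom A B sat x p

/-- `(A,B)^{(1,n)}` has a global deadlock: a finite maximal path (a finite run) ending
in a configuration where no process is enabled. -/
def hasGlobalDeadlock (n : ℕ) : Prop :=
  ∃ (m : ℕ) (s : ℕ → GState QA QB n) (e : ℕ → GInput SA SB n) (mv : ℕ → Proc n),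
    isInit A B (s 0) ∧
    (∀ t < m, step A B sat (s t) (e t) (mv t) (s (t + 1))) ∧
    (∀ t < m, ∀ p, p ≠ mv t → inp (e (t + 1)) p = inp (e t) p) ∧
    ∀ p, ¬ enabled A B sat (s m) (e m) p

/-- Unconditional fairness: every process moves infinitely often. -/
def uncondFair {n : ℕ} (x : Run A B sat n) : Prop :=
  ∀ p, ∀ t, ∃ t' ≥ t, x.mv t' = p

/-- Strong fairness: every process enabled infinitely often moves infinitely often. -/
def strongFair {n : ℕ} (x : Run A B sat n) : Prop :=
  ∀ p, (∀ t, ∃ t' ≥ t, enabled A B sat (x.s t') (x.e t') p) → (∀ t, ∃ t' ≥ t, x.mv t' = p)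

/-- Initializing run: every process that moves infinitely often visits its
initial state infinitely often. -/
def initializing {n : ℕ} (x : Run A B sat n) : Prop :=
  ∀ p, (∀ t, ∃ t' ≥ t, x.mv t' = p) →
    ∀ t, ∃ t' ≥ t, view (x.s t') p = (match p with
      | none => Sum.inl A.init
      | some _ => Sum.inr B.init)

end System

/-- LTL without the next-time operator (`LTL\X`). -/
inductive LTL (P : Type) : Type
  | atom : P → LTL P
  | tru : LTL P
  | not : LTL P → LTL P
  | and : LTL P → LTL P → LTL P
  | untl : LTL P → LTL P → LTL P

/-- Semantics of `LTL\X` over a trace `w` of valuations. -/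
def LTL.holds {P : Type} (w : ℕ → P → Prop) : LTL P → ℕ → Prop
  | .atom a, t => w t a
  | .tru, _ => True
  | .not f, t => ¬ LTL.holds w f t
  | .and f g, t => LTL.holds w f t ∧ LTL.holds w g t
  | .untl f g, t => ∃ t', t ≤ t' ∧ LTL.holds w g t' ∧ ∀ u, t ≤ u → u < t' → LTL.holds w f u

/-- Atomic propositions of a `k`-indexed formula `h(A, B_{i_1}, …, B_{i_k})`:
states/inputs of `A` and indexed states/inputs of `k` `B`-processes. -/
abbrev AtomK (QA SA QB SB : Type) (k : ℕ) := (QA ⊕ SA) ⊕ ((QB ⊕ SB) × Fin k)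

section Spec

variable (A : Template QA SA Gd) (B : Template QB SB Gd)
variable (sat : Set (QA ⊕ QB) → Gd → Prop)

/-- The trace of valuations of the atomic propositions along run `x`, where the `k`
indexed `B`-processes are given by `ι`. -/
def traceK {n k : ℕ} (x : Run A B sat n) (ι : Fin k → Fin n) :
    ℕ → AtomK QA SA QB SB k → Prop := fun t a =>
  match a with
  | Sum.inl (Sum.inl qa) => (x.s t).1 = qa
  | Sum.inl (Sum.inr sa) => (x.e t).1 = sa
  | Sum.inr (Sum.inl qb, i) => (x.s t).2 (ι i) = qb
  | Sum.inr (Sum.inr sb, i) => (x.e t).2 (ι i) = sb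

/-- `(A,B)^{(1,n)} ⊨ ∀ i_1,…,i_k. E h`, relative to a fairness constraint `F` on runs. -/
def satE (k n : ℕ) (F : Run A B sat n → Prop) (h : LTL (AtomK QA SA QB SB k)) : Prop :=
  ∀ ι : Fin k ↪ Fin n, ∃ x : Run A B sat n, F x ∧ LTL.holds (traceK A B sat x ι) h 0

/-- `(A,B)^{(1,n)} ⊨ ∀ i_1,…,i_k. A h`, relative to a fairness constraint `F` on runs. -/
def satA (k n : ℕ) (F : Run A B sat n → Prop) (h : LTL (AtomK QA SA QB SB k)) : Prop :=
  ∀ ι : Fin k ↪ Fin n, ∀ x : Run A B sat n, F x → LTL.holds (traceK A B sat x ι) h 0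

/-- `c` is a cutoff for `k`-indexed `LTL\X` properties (w.r.t. fairness `F`). -/
def kCutoff (F : ∀ n, Run A B sat n → Prop) (k c : ℕ) : Prop :=
  ∀ (h : LTL (AtomK QA SA QB SB k)) (n : ℕ), c ≤ n →
    ((satE A B sat k n (F n) h ↔ satE A B sat k c (F c) h) ∧
     (satA A B sat k n (F n) h ↔ satA A B sat k c (F c) h))

end Spec

/-- All guards appearing in transitions of a template. -/
def guardsOf {Q Sig Gd : Type} (T : Template Q Sig Gd) : Set Gd :=
  {g | ∃ q σ q', (q, σ, g, q') ∈ T.trans}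

/-- The non-trivial guards of a template (different from `Q_A ∪ Q_B` and `∅`). -/
def ntGuards {Q Sig St : Type} (T : Template Q Sig (Set St)) : Set (Set St) :=
  {g | g ∈ guardsOf T ∧ g ≠ Set.univ ∧ g ≠ ∅}

/-- `|G| = |G_A ∪ G_B|`, the number of non-trivial guards of the system. -/
noncomputable def numG (A : Template QA SA (Set (QA ⊕ QB))) (B : Template QB SB (Set (QA ⊕ QB))) : ℕ :=
  (ntGuards A ∪ ntGuards B).ncard

/-- `Enable_q`: the states of `A` and `B` that enable some transition from `q` in `B`. -/
def EnableSet (B : Template QB SB (Set (QA ⊕ QB))) (q : QB) : Set (QA ⊕ QB) :=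
  {x | ∃ σ g q'', (q, σ, g, q'') ∈ B.trans ∧ x ∈ g}

section Conj

variable (A : Template QA SA (Set (QA ⊕ QB))) (B : Template QB SB (Set (QA ⊕ QB)))

/-- The standing assumption on conjunctive systems: `init_A` and `init_B`
are contained in all guards. -/
def conjInitAssumption : Prop :=
  ∀ g ∈ guardsOf A ∪ guardsOf B, Sum.inl A.init ∈ g ∧ Sum.inr B.init ∈ g

/-- The guards of the transitions from a local state of the system. -/
def guardsFrom : QA ⊕ QB → Set (Set (QA ⊕ QB))
  | Sum.inl q => {g | ∃ σ q', (q, σ, g, q') ∈ A.trans}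
  | Sum.inr q => {g | ∃ σ q', (q, σ, g, q') ∈ B.trans}

/-- `D` is a deadset of state `st` (contains at most one `A`-state, hits every guard of a
transition from `st`, and each of its members violates some guard from `st`). -/
def IsDeadset (st : QA ⊕ QB) (D : Set (QA ⊕ QB)) : Prop :=
  (∀ x ∈ D, ∀ y ∈ D, x.isLeft → y.isLeft → x = y) ∧
  (∀ g ∈ guardsFrom A B st, ∃ x ∈ D, x ∉ g) ∧
  (∀ x ∈ D, ∃ g ∈ guardsFrom A B st, x ∉ g)

/-- A state is free if it has no deadset. -/
def IsFreeState (st : QA ⊕ QB) : Prop := ¬ ∃ D, IsDeadset A B st D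

/-- A state is non-blocking if it appears in no deadset of any state. -/
def IsNonBlocking (x : QA ⊕ QB) : Prop := ∀ st D, IsDeadset A B st D → x ∉ D

/-- A state is not self-blocking if it appears in no deadset of itself. -/
def IsNotSelfBlocking (st : QA ⊕ QB) : Prop := ∀ D, IsDeadset A B st D → st ∉ D

/-- A locally deadlocked run that is alternation-free: eventually one single deadset of the
deadlocked state remains covered forever (no infinite alternation between deadsets). -/
def altFreeLockedRun {n : ℕ} (x : Run A B conjSat n) (p : Proc n) : Prop :=
  ∃ t0 D, (∀ t ≥ t0, ¬ enabled A B conjSat (x.s t) (x.e t) p) ∧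
    IsDeadset A B (view (x.s t0) p) D ∧ ∀ t ≥ t0, D ⊆ others (x.s t) p

end Conj

section UProps

variable {QU SU : Type}
variable (U : Template QU SU (Set (QA ⊕ QB))) (emb : QU → QA ⊕ QB)

/-- Guards of transitions from state `q` of template `U`. -/
def uGFrom (q : QU) : Set (Set (QA ⊕ QB)) := {g | ∃ σ q', (q, σ, g, q') ∈ U.trans}

/-- A deadset of state `q` of template `U`. -/
def uDeadset (q : QU) (D : Set (QA ⊕ QB)) : Prop :=
  (∀ x ∈ D, ∀ y ∈ D, x.isLeft → y.isLeft → x = y) ∧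
  (∀ g ∈ uGFrom U q, ∃ x ∈ D, x ∉ g) ∧
  (∀ x ∈ D, ∃ g ∈ uGFrom U q, x ∉ g)

/-- A state of `U` is free if it has no deadset. -/
def uFreeState (q : QU) : Prop := ¬ ∃ D, uDeadset U q D

/-- A `1`-conjunctive guard excludes exactly one state. -/
def OneConjGuard (g : Set (QA ⊕ QB)) : Prop := ∃ x : QA ⊕ QB, g = {x}ᶜ

/-- A state is `1`-conjunctive if all its non-trivial guards are `1`-conjunctive. -/
def uOneConjState (q : QU) : Prop :=
  ∀ g ∈ uGFrom U q, g ≠ Set.univ → g ≠ ∅ → OneConjGuard g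

/-- A template is `1`-conjunctive if all its states are. -/
def uOneConj : Prop := ∀ q : QU, uOneConjState U q

/-- Effectively `1`-conjunctive: every state is `1`-conjunctive or free. -/
def uEff1Conj : Prop := ∀ q : QU, uOneConjState U q ∨ uFreeState U q

/-- Transitions of `U`, as quadruples. -/
abbrev Edge (QU SU St : Type) := QU × SU × Set St × QU

def esrc {St : Type} (e : Edge QU SU St) : QU := e.1
def etgt {St : Type} (e : Edge QU SU St) : QU := e.2.2.2
def egrd {St : Type} (e : Edge QU SU St) : Set St := e.2.2.1

/-- A connected sequence of transitions of `U`. -/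
def uEPath (l : List (Edge QU SU (QA ⊕ QB))) : Prop :=
  (∀ e ∈ l, e ∈ U.trans) ∧ l.Chain' (fun e e' => etgt e = esrc e')

/-- A cycle through `q`: a nonempty connected transition sequence from `q` back to `q`
visiting pairwise distinct states. -/
def uIsCycle (q : QU) (l : List (Edge QU SU (QA ⊕ QB))) : Prop :=
  l ≠ [] ∧ uEPath U l ∧
  (∃ e0 ∈ l.head?, esrc e0 = q) ∧ (∃ en ∈ l.getLast?, etgt en = q) ∧
  (l.map esrc).Nodup

/-- The states on a cycle (or transition sequence). -/
def cycStates {St : Type} (l : List (Edge QU SU St)) : Set QU := {s | ∃ e ∈ l, esrc e = s}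

/-- The guards on a cycle (or transition sequence). -/
def cycGuards {St : Type} (l : List (Edge QU SU St)) : Set (Set St) := {g | ∃ e ∈ l, egrd e = g}

/-- A lasso: a connected transition sequence starting at the initial state and
ending with a cycle. -/
def uIsLasso (l : List (Edge QU SU (QA ⊕ QB))) : Prop :=
  uEPath U l ∧ (∃ e0 ∈ l.head?, esrc e0 = U.init) ∧
  ∃ l1 l2 q, l = l1 ++ l2 ∧ uIsCycle U q l2

/-- `D` disables all `n`-conjunctive guards with `n > 1` of transitions from `q`. -/
def uDisablesBig (q : QU) (D : Set (QA ⊕ QB)) : Prop :=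
  ∀ g ∈ uGFrom U q, g ≠ Set.univ → 2 ≤ (gᶜ).ncard → ∃ x ∈ D, x ∉ g

/-- Freely traversable template: for every non-free state `q` and every set of states
disabling the `n`-conjunctive guards (`n > 1`) from `q`, there is a lasso whose guards
avoid `¬q`, avoid all `¬q_i`, and avoid all `1`-conjunctive guards from `q`. -/
def uFreelyTraversable : Prop :=
  ∀ q : QU, ¬ uFreeState U q → ∀ D, uDisablesBig U q D →
    ∃ l, uIsLasso U l ∧ ∀ g ∈ cycGuards l,
      emb q ∈ g ∧ (∀ x ∈ D, x ∈ g) ∧ ∀ x : QA ⊕ QB, ({x}ᶜ ∈ uGFrom U q) → x ∈ g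

/-- `x` has a cycle through it that is disjoint from all cycles through `q` and
whose guards never exclude `q`. -/
def uBadCycleFor (q : QU) (x : QA ⊕ QB) : Prop :=
  ∃ qx : QU, emb qx = x ∧ ∃ c, uIsCycle U qx c ∧
    (∀ s ∈ cycStates c, ¬ ∃ cq, uIsCycle U q cq ∧ s ∈ cycStates cq) ∧
    (∀ g ∈ cycGuards c, emb q ∈ g)

/-- Alternation-free template. -/
def uAltFree : Prop :=
  (∀ q : QU, ¬ uFreeState U q → ∀ D, uDisablesBig U q D →
    ∀ x ∈ D, ∀ y ∈ D, uBadCycleFor U emb q x → uBadCycleFor U emb q y → x = y) ∨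
  (∀ q : QU, ¬ uFreeState U q → ∀ g ∈ uGFrom U q, 2 ≤ (gᶜ).ncard →
    ∃ x ∈ gᶜ, {x}ᶜ ∈ uGFrom U q)

end UProps


/-- `LTL\X` is invariant under stuttering. -/
theorem LTL.holds_iff_of_stutter {P : Type} {w w' : ℕ → P → Prop} {ρ : ℕ → ℕ}
    (hmono : Monotone ρ) (hsurj : Function.Surjective ρ) (hw : ∀ m, w m = w' (ρ m))
    (f : LTL P) (m : ℕ) : LTL.holds w f m ↔ LTL.holds w' f (ρ m) := by
  induction f generalizing m with
  | atom a => simp [LTL.holds, hw]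
  | tru => simp [LTL.holds]
  | not f ih => simp [LTL.holds, ih]
  | and f g ihf ihg => simp [LTL.holds, ihf, ihg]
  | untl f g ihf ihg =>
    simp only [LTL.holds]
    constructor
    · rintro ⟨t', hmt, hg, hf⟩
      refine ⟨ρ t', hmono hmt, (ihg _).1 hg, fun u hu hut => ?_⟩
      obtain ⟨v, rfl⟩ := hsurj u
      have hvt : v < t' := hmono.reflect_lt hut
      by_cases hmv : m ≤ v
      · exact (ihf _).1 (hf v hmv hvt)
      · have : ρ v = ρ m := le_antisymm (hmono (not_le.1 hmv).le) hu
        rw [this] at hut ⊢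
        exact (ihf _).1 (hf m le_rfl (hmono.reflect_lt hut))
    · rintro ⟨τ, hτ, hg, hf⟩
      have hex : ∃ v, m ≤ v ∧ ρ v = τ := by
        obtain ⟨v, rfl⟩ := hsurj τ
        by_cases hmv : m ≤ v
        · exact ⟨v, hmv, rfl⟩
        · exact ⟨m, le_rfl, le_antisymm hτ (hmono (not_le.1 hmv).le)⟩
      classical
      obtain ⟨h1, h2⟩ := Nat.find_spec hex
      refine ⟨Nat.find hex, h1, (ihg _).2 (h2.symm ▸ hg), fun u hu hut => (ihf _).2 (hf _ (hmono hu) ?_)⟩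
      have hle : ρ u ≤ τ := h2 ▸ hmono hut.le
      exact lt_of_le_of_ne hle fun h => Nat.find_min hex hut ⟨hu, h⟩

section Views

variable {n : ℕ}

theorem gstate_ext {s s' : GState QA QB n} (h : ∀ p, view s p = view s' p) : s = s' :=
  Prod.ext (Sum.inl_injective (h none)) (funext fun i => Sum.inr_injective (h (some i)))

/-- The transitions of `A` and `B`, on the disjoint unions of states and inputs. -/
def jointTrans (A : Template QA SA Gd) (B : Template QB SB Gd) :
    QA ⊕ QB → SA ⊕ SB → Gd → QA ⊕ QB → Prop
  | Sum.inl q, Sum.inl a, g, Sum.inl q' => (q, a, g, q') ∈ A.trans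
  | Sum.inr q, Sum.inr b, g, Sum.inr q' => (q, b, g, q') ∈ B.trans
  | _, _, _, _ => False

theorem step_iff {A : Template QA SA Gd} {B : Template QB SB Gd}
    {sat : Set (QA ⊕ QB) → Gd → Prop} {s s' : GState QA QB n} {e : GInput SA SB n} {p : Proc n} :
    step A B sat s e p s' ↔
      (∃ g, jointTrans A B (view s p) (inp e p) g (view s' p) ∧ sat (others s p) g) ∧
      ∀ p', p' ≠ p → view s' p' = view s p' := by
  cases p with
  | none =>
    constructor
    · rintro ⟨g, q', h1, h2, rfl⟩
      refine ⟨⟨g, h1, h2⟩, fun p' hp' => ?_⟩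
      cases p' with
      | none => exact absurd rfl hp'
      | some i => rfl
    · rintro ⟨⟨g, h1, h2⟩, h3⟩
      refine ⟨g, s'.1, h1, h2, gstate_ext fun p' => ?_⟩
      cases p' with
      | none => rfl
      | some i => exact h3 (some i) (by simp)
  | some i =>
    constructor
    · rintro ⟨g, q', h1, h2, rfl⟩
      refine ⟨⟨g, by simpa [view, jointTrans, inp] using h1, h2⟩, fun p' hp' => ?_⟩
      cases p' with
      | none => rfl
      | some j =>
        have : j ≠ i := fun h => hp' (by rw [h])
        simp [view, this]
    · rintro ⟨⟨g, h1, h2⟩, h3⟩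
      refine ⟨g, s'.2 i, h1, h2, gstate_ext fun p' => ?_⟩
      cases p' with
      | none => exact h3 none (by simp)
      | some j =>
        by_cases hj : j = i
        · subst hj; simp [view]
        · simpa [view, hj] using h3 (some j) (by simpa using hj)

open Classical in
/-- The configuration that agrees with `s'` on the processes in `c` and with `s` elsewhere. -/
noncomputable def mix {X Y : Type} (c : Set (Proc n)) (s s' : X × (Fin n → Y)) :
    X × (Fin n → Y) :=
  (if none ∈ c then s'.1 else s.1, fun i => if some i ∈ c then s'.2 i else s.2 i)

theorem view_mix_of_mem {c : Set (Proc n)} (s s' : GState QA QB n) {p : Proc n} (h : p ∈ c) :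
    view (mix c s s') p = view s' p := by
  cases p <;> simp [view, mix, h]

theorem view_mix_of_notMem {c : Set (Proc n)} (s s' : GState QA QB n) {p : Proc n} (h : p ∉ c) :
    view (mix c s s') p = view s p := by
  cases p <;> simp [view, mix, h]

theorem inp_eq_view (e : GInput SA SB n) (p : Proc n) : inp e p = view e p := by
  cases p <;> rfl

/-- The valuations of the atomic propositions that refer to `A` and `B_i`. -/
def localTrace (s : ℕ → GState QA QB n) (e : ℕ → GInput SA SB n) (i : Fin n) :
    ℕ → AtomK QA SA QB SB 1 → Prop := fun t a =>
  match a with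
  | Sum.inl (Sum.inl qa) => (s t).1 = qa
  | Sum.inl (Sum.inr sa) => (e t).1 = sa
  | Sum.inr (Sum.inl qb, _) => (s t).2 i = qb
  | Sum.inr (Sum.inr sb, _) => (e t).2 i = sb

theorem traceK_eq_localTrace {A : Template QA SA Gd} {B : Template QB SB Gd}
    {sat : Set (QA ⊕ QB) → Gd → Prop} (x : Run A B sat n) (i : Fin n) :
    traceK A B sat x (fun _ : Fin 1 => i) = localTrace x.s x.e i := by
  funext t a
  rcases a with (_ | _) | ⟨_ | _, _⟩ <;> rfl

theorem localTrace_congr {s s' : ℕ → GState QA QB n} {e e' : ℕ → GInput SA SB n} {i : Fin n}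
    {t t' : ℕ} (hs : ∀ p, p = none ∨ p = some i → view (s t) p = view (s' t') p)
    (he : ∀ p, p = none ∨ p = some i → view (e t) p = view (e' t') p) :
    localTrace s e i t = localTrace s' e' i t' := by
  have h1 : (s t).1 = (s' t').1 := Sum.inl_injective (hs none (.inl rfl))
  have h2 : (s t).2 i = (s' t').2 i := Sum.inr_injective (hs (some i) (.inr rfl))
  have h3 : (e t).1 = (e' t').1 := Sum.inl_injective (he none (.inl rfl))
  have h4 : (e t).2 i = (e' t').2 i := Sum.inr_injective (he (some i) (.inr rfl))
  funext a
  rcases a with (_ | _) | ⟨_ | _, _⟩ <;> simp [localTrace, h1, h2, h3, h4]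

end Views

section Serialize

variable {n : ℕ} {A : Template QA SA Gd} {B : Template QB SB Gd}
  {sat : Set (QA ⊕ QB) → Gd → Prop}

/-- Idle moments can be removed from a fair sequence of configurations. -/
theorem exists_run_of_idle (s : ℕ → GState QA QB n) (e : ℕ → GInput SA SB n)
    (mv : ℕ → Option (Proc n)) (hinit : isInit A B (s 0))
    (hstep : ∀ t p, mv t = some p → step A B sat (s t) (e t) p (s (t + 1)) ∧
      ∀ p', p' ≠ p → inp (e (t + 1)) p' = inp (e t) p')
    (hidle : ∀ t, mv t = none → s (t + 1) = s t ∧ e (t + 1) = e t)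
    (hfair : ∀ p T, ∃ t ≥ T, mv t = some p) (i : Fin n) (h : LTL (AtomK QA SA QB SB 1)) :
    ∃ x : Run A B sat n, uncondFair A B sat x ∧
      (LTL.holds (localTrace s e i) h 0 ↔ LTL.holds (localTrace x.s x.e i) h 0) := by
  classical
  let I : ℕ → Prop := fun t => mv t ≠ none
  have hI : {t | I t}.Infinite := by
    refine Set.infinite_of_not_bddAbove fun ⟨b, hb⟩ => ?_
    obtain ⟨t, ht, h'⟩ := hfair none (b + 1)
    have : t ≤ b := hb (show mv t ≠ none by simp [h'])
    omega
  have hconst : ∀ d t, (∀ u, t ≤ u → u < t + d → ¬ I u) → s (t + d) = s t ∧ e (t + d) = e t := by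
    intro d t
    induction d with
    | zero => simp
    | succ d ih =>
      intro hu
      obtain ⟨h1, h2⟩ := ih fun u h1 h2 => hu u h1 (by omega)
      obtain ⟨h3, h4⟩ := hidle (t + d) (not_not.1 (hu (t + d) (by omega) (by omega)))
      exact ⟨h3.trans h1, h4.trans h2⟩
  have hnext : ∀ t, s (Nat.nth I (Nat.count I t)) = s t ∧ e (Nat.nth I (Nat.count I t)) = e t := by
    intro t
    have hle : t ≤ Nat.nth I (Nat.count I t) := Nat.le_nth_count hI t
    obtain ⟨d, hd⟩ := Nat.exists_eq_add_of_le hle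
    rw [hd]
    refine hconst d t fun u htu hud hu => ?_
    rw [← hd] at hud
    have h1 := Nat.count_strict_mono hu hud
    rw [Nat.count_nth_of_infinite hI] at h1
    exact absurd (Nat.count_monotone I htu) (by omega)
  have hmem : ∀ k, mv (Nat.nth I k) ≠ none := fun k => Nat.nth_mem_of_infinite hI k
  have hmv : ∀ k, mv (Nat.nth I k) = some ((mv (Nat.nth I k)).get (Option.isSome_iff_ne_none.2 (hmem k))) :=
    fun k => by simp
  have hsucc : ∀ k, s (Nat.nth I (k + 1)) = s (Nat.nth I k + 1) ∧
      e (Nat.nth I (k + 1)) = e (Nat.nth I k + 1) := by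
    intro k
    have : Nat.count I (Nat.nth I k + 1) = k + 1 := Nat.count_nth_succ_of_infinite hI k
    simpa [this] using hnext (Nat.nth I k + 1)
  refine ⟨⟨fun k => s (Nat.nth I k), fun k => e (Nat.nth I k),
    fun k => (mv (Nat.nth I k)).get (Option.isSome_iff_ne_none.2 (hmem k)), ?_, ?_, ?_⟩, ?_, ?_⟩
  · have := (hnext 0).1
    simp only [Nat.count_zero] at this
    rwa [this]
  · intro k
    rw [(hsucc k).1]
    exact (hstep _ _ (hmv k)).1
  · intro k p hp
    rw [(hsucc k).2]
    exact (hstep _ _ (hmv k)).2 p hp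
  · intro p T
    obtain ⟨t, ht, hp⟩ := hfair p (Nat.nth I T)
    have hIt : I t := by simp [I, hp]
    refine ⟨Nat.count I t, ?_, ?_⟩
    · have := Nat.count_monotone I ht
      rwa [Nat.count_nth_of_infinite hI] at this
    · simp [Nat.nth_count hIt, hp]
  · have := LTL.holds_iff_of_stutter (w := localTrace s e i)
      (w' := localTrace (fun k => s (Nat.nth I k)) (fun k => e (Nat.nth I k)) i)
      (ρ := Nat.count I) (Nat.count_monotone I)
      (fun k => ⟨Nat.nth I k, Nat.count_nth_of_infinite hI k⟩)
      (fun m => localTrace_congr (by simp [(hnext m).1]) (by simp [(hnext m).2])) h 0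
    simpa using this

end Serialize

section Simultaneous

variable {n : ℕ} {A : Template QA SA (Set (QA ⊕ QB))} {B : Template QB SB (Set (QA ⊕ QB))}

/-- If sets of processes move simultaneously, with every guard witnessed by a process at rest,
then the moves can be serialized. -/
theorem exists_run_of_simultaneous (s : ℕ → GState QA QB n) (e : ℕ → GInput SA SB n)
    (M : ℕ → Set (Proc n)) (i : Fin n) (hinit : isInit A B (s 0))
    (hmove : ∀ t, ∀ p ∈ M t, ∃ g, jointTrans A B (view (s t) p) (inp (e t) p) g
      (view (s (t + 1)) p) ∧ ∃ p' ∉ M t, view (s t) p' ∈ g)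
    (hrest : ∀ t, ∀ p ∉ M t, view (s (t + 1)) p = view (s t) p ∧
      inp (e (t + 1)) p = inp (e t) p)
    (hex : ∀ t, none ∈ M t → some i ∉ M t)
    (hfair : ∀ p T, ∃ t ≥ T, p ∈ M t) (h : LTL (AtomK QA SA QB SB 1)) :
    ∃ x : Run A B disjSat n, uncondFair A B disjSat x ∧
      (LTL.holds (localTrace s e i) h 0 ↔ LTL.holds (localTrace x.s x.e i) h 0) := by
  classical
  let L := n + 1
  let sl : Proc n → ℕ := fun p => match p with
    | none => n
    | some j => if j = i then n else j
  have hL : 0 < L := Nat.succ_pos n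
  have hsl : ∀ p, sl p < L := by
    rintro (_ | j)
    · exact Nat.lt_succ_self n
    · have := j.2
      simp only [sl, L]; split <;> omega
  have hinj : ∀ t, ∀ p ∈ M t, ∀ p' ∈ M t, sl p = sl p' → p = p' := by
    rintro t (_ | j) hp (_ | j') hp' heq
    · rfl
    · have := j'.2
      by_cases hj : j' = i
      · exact absurd (hj ▸ hp') (hex t hp)
      · simp only [sl, if_neg hj] at heq; omega
    · have := j.2
      by_cases hj : j = i
      · exact absurd (hj ▸ hp) (hex t hp')
      · simp only [sl, if_neg hj] at heq; omega
    · have := j.2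
      have := j'.2
      simp only [sl] at heq
      congr 1
      split_ifs at heq with h1 h2 h2
      · rw [h1, h2]
      · omega
      · omega
      · exact Fin.ext heq
  have hvis : ∀ p, p = none ∨ p = some i → sl p = n := by
    rintro p (rfl | rfl) <;> simp [sl]
  let c : ℕ → Set (Proc n) := fun k => {p | sl p < k % L}
  let s' : ℕ → GState QA QB n := fun k => mix (c k) (s (k / L)) (s (k / L + 1))
  let e' : ℕ → GInput SA SB n := fun k => mix (c k) (e (k / L)) (e (k / L + 1))
  have hsucc : ∀ k, ((k + 1) / L = k / L ∧ (k + 1) % L = k % L + 1) ∨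
      ((k + 1) / L = k / L + 1 ∧ (k + 1) % L = 0 ∧ k % L = n) := by
    intro k
    have h1 := Nat.div_add_mod k L
    have h2 := Nat.mod_lt k hL
    by_cases hk : k % L + 1 < L
    · left
      have : k + 1 = L * (k / L) + (k % L + 1) := by omega
      constructor
      · rw [this, Nat.mul_add_div hL, Nat.div_eq_of_lt hk]; rfl
      · rw [this, Nat.mul_add_mod, Nat.mod_eq_of_lt hk]
    · right
      have h3 : k % L = n := by omega
      have : k + 1 = L * (k / L + 1) + 0 := by rw [mul_add]; omega
      refine ⟨?_, ?_, h3⟩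
      · rw [this, Nat.mul_add_div hL]; simp
      · rw [this, Nat.mul_add_mod]; simp
  have hnow : ∀ (X Y : Type) (f : ℕ → GState X Y n) k p, k % L ≤ sl p →
      view (mix (c k) (f (k / L)) (f (k / L + 1))) p = view (f (k / L)) p :=
    fun X Y f k p hp => view_mix_of_notMem _ _ (not_lt.2 hp)
  have hlater : ∀ (X Y : Type) (f : ℕ → GState X Y n) k p, sl p ≤ k % L →
      view (mix (c (k + 1)) (f ((k + 1) / L)) (f ((k + 1) / L + 1))) p = view (f (k / L + 1)) p := by
    intro X Y f k p hp
    rcases hsucc k with ⟨h1, h2⟩ | ⟨h1, h2, h3⟩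
    · rw [view_mix_of_mem _ _ (show sl p < (k + 1) % L by omega), h1]
    · rw [view_mix_of_notMem _ _ (show ¬ sl p < (k + 1) % L by omega), h1]
  have hsame : ∀ (X Y : Type) (f : ℕ → GState X Y n) k p, sl p ≠ k % L →
      view (mix (c (k + 1)) (f ((k + 1) / L)) (f ((k + 1) / L + 1))) p =
        view (mix (c k) (f (k / L)) (f (k / L + 1))) p := by
    intro X Y f k p hp
    rcases lt_or_gt_of_ne hp with hlt | hgt
    · rw [hlater X Y f k p hlt.le, view_mix_of_mem _ _ (show sl p < k % L from hlt)]
    · rw [hnow X Y f k p hgt.le]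
      rcases hsucc k with ⟨h1, h2⟩ | ⟨h1, h2, h3⟩
      · rw [view_mix_of_notMem _ _ (show ¬ sl p < (k + 1) % L by omega), h1]
      · have := hsl p
        omega
  have hstay : ∀ k, ∀ p ∉ M (k / L), view (s' k) p = view (s (k / L)) p ∧
      view (s' (k + 1)) p = view (s' k) p ∧ inp (e' (k + 1)) p = inp (e' k) p := by
    intro k p hp
    obtain ⟨h1, h2⟩ := hrest _ p hp
    rw [inp_eq_view, inp_eq_view] at h2
    have hs : ∀ (X Y : Type) (f : ℕ → GState X Y n), view (f (k / L + 1)) p = view (f (k / L)) p →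
        view (mix (c k) (f (k / L)) (f (k / L + 1))) p = view (f (k / L)) p := by
      intro X Y f hf
      by_cases hc : p ∈ c k
      · rw [view_mix_of_mem _ _ hc, hf]
      · rw [view_mix_of_notMem _ _ hc]
    have hs' : ∀ (X Y : Type) (f : ℕ → GState X Y n), view (f (k / L + 1)) p = view (f (k / L)) p →
        view (mix (c (k + 1)) (f ((k + 1) / L)) (f ((k + 1) / L + 1))) p =
          view (mix (c k) (f (k / L)) (f (k / L + 1))) p := by
      intro X Y f hf
      by_cases hc : sl p = k % L
      · rw [hlater X Y f k p hc.le, hs X Y f hf, hf]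
      · exact hsame X Y f k p hc
    rw [inp_eq_view, inp_eq_view]
    exact ⟨hs _ _ s h1, hs' _ _ s h1, hs' _ _ e h2⟩
  let act : ℕ → Proc n → Prop := fun k p => sl p = k % L ∧ p ∈ M (k / L)
  let mv : ℕ → Option (Proc n) := fun k => if hk : ∃ p, act k p then some hk.choose else none
  have hmv : ∀ k p, mv k = some p ↔ act k p := by
    intro k p
    by_cases hk : ∃ p, act k p
    · have h1 := hk.choose_spec
      simp only [mv, dif_pos hk, Option.some.injEq]
      exact ⟨fun h => h ▸ h1, fun h => hinj _ _ h1.2 _ h.2 (h1.1.trans h.1.symm)⟩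
    · simp only [mv, dif_neg hk]
      exact ⟨fun h => by simp at h, fun h => absurd ⟨p, h⟩ hk⟩
  have hpass : ∀ k p, ¬ act k p → view (s' (k + 1)) p = view (s' k) p ∧
      inp (e' (k + 1)) p = inp (e' k) p := by
    intro k p hp
    by_cases hM : p ∈ M (k / L)
    · have hne : sl p ≠ k % L := fun h => hp ⟨h, hM⟩
      rw [inp_eq_view, inp_eq_view]
      exact ⟨hsame _ _ s k p hne, hsame _ _ e k p hne⟩
    · exact (hstay k p hM).2
  obtain ⟨x, hxf, hx⟩ := exists_run_of_idle (A := A) (B := B) (sat := disjSat) s' e' mv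
    (by
      have : s' 0 = s 0 := gstate_ext fun p => by
        have := hnow _ _ s 0 p (by simp)
        simpa [s'] using this
      rwa [this])
    (by
      intro k p hk
      rw [hmv] at hk
      have hoth : ∀ p', p' ≠ p → ¬ act k p' := fun p' hne h' =>
        hne (hinj _ _ h'.2 _ hk.2 (h'.1.trans hk.1.symm))
      refine ⟨step_iff.2 ⟨?_, fun p' hp' => (hpass k p' (hoth p' hp')).1⟩,
        fun p' hp' => (hpass k p' (hoth p' hp')).2⟩
      obtain ⟨g, hg, p', hp', hpg⟩ := hmove _ p hk.2
      have e1 : view (s' k) p = view (s (k / L)) p := hnow _ _ s k p hk.1.ge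
      have e2 : inp (e' k) p = inp (e (k / L)) p := by
        rw [inp_eq_view, inp_eq_view]; exact hnow _ _ e k p hk.1.ge
      have e3 : view (s' (k + 1)) p = view (s (k / L + 1)) p := hlater _ _ s k p hk.1.le
      refine ⟨g, by rwa [e1, e2, e3], _, ⟨p', fun h => hp' (h ▸ hk.2), rfl⟩, ?_⟩
      rwa [(hstay k p' hp').1])
    (by
      intro k hk
      have : ∀ p, ¬ act k p := fun p hp => by simp [(hmv k p).2 hp] at hk
      refine ⟨gstate_ext fun p => (hpass k p (this p)).1, gstate_ext fun p => ?_⟩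
      rw [← inp_eq_view, ← inp_eq_view]
      exact (hpass k p (this p)).2)
    (by
      intro p T
      obtain ⟨t, ht, hp⟩ := hfair p T
      have h1 : (L * t + sl p) / L = t := by
        rw [Nat.mul_add_div hL, Nat.div_eq_of_lt (hsl p)]; rfl
      have h2 : (L * t + sl p) % L = sl p := by
        rw [Nat.mul_add_mod, Nat.mod_eq_of_lt (hsl p)]
      refine ⟨L * t + sl p, ?_, (hmv _ _).2 ⟨h2.symm, by rwa [h1]⟩⟩
      have : t ≤ L * t := Nat.le_mul_of_pos_left t hL
      omega) i h
  refine ⟨x, hxf, Iff.trans (Iff.symm ?_) hx⟩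
  have := LTL.holds_iff_of_stutter (w := localTrace s' e' i) (w' := localTrace s e i)
    (ρ := fun k => k / L) (fun a b hab => Nat.div_le_div_right hab)
    (fun t => ⟨L * t, Nat.mul_div_cancel_left t hL⟩)
    (fun k => by
      have hle : ∀ p, p = none ∨ p = some i → k % L ≤ sl p := fun p hp => by
        have := Nat.mod_lt k hL
        rw [hvis p hp]; omega
      exact localTrace_congr (fun p hp => hnow _ _ s k p (hle p hp))
        (fun p hp => hnow _ _ e k p (hle p hp))) h 0
  simpa using this

end Simultaneous

section Tracking

variable {n : ℕ} {A : Template QA SA Gd} {B : Template QB SB Gd}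
  {sat : Set (QA ⊕ QB) → Gd → Prop}

theorem Run.view_succ_of_ne (x : Run A B sat n) {t : ℕ} {p : Proc n} (h : p ≠ x.mv t) :
    view (x.s (t + 1)) p = view (x.s t) p :=
  (step_iff.1 (x.steps t)).2 p h

theorem Run.state_succ_of_ne (x : Run A B sat n) {t : ℕ} {k : Fin n} (h : x.mv t ≠ some k) :
    (x.s (t + 1)).2 k = (x.s t).2 k :=
  Sum.inr_injective (x.view_succ_of_ne h.symm)

theorem Run.input_succ_of_ne (x : Run A B sat n) {t : ℕ} {k : Fin n} (h : x.mv t ≠ some k) :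
    (x.e (t + 1)).2 k = (x.e t).2 k :=
  Sum.inr_injective (x.persist t _ h.symm)

/-- A local path of a `B`-process with states `st` and inputs `i`, moving at the moments in `m`,
each move being a copy of a simultaneous move in `x` of some `B`-process other than `B_b`. -/
structure Tracks (x : Run A B sat n) (b : Fin n) (st : ℕ → QB) (i : ℕ → SB) (m : Set ℕ) :
    Prop where
  move : ∀ t ∈ m, ∃ k ≠ b, x.mv t = some k ∧ st t = (x.s t).2 k ∧ i t = (x.e t).2 k ∧
    st (t + 1) = (x.s (t + 1)).2 k
  rest : ∀ t ∉ m, st (t + 1) = st t ∧ i (t + 1) = i t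
  fair : ∀ T, ∃ t ≥ T, t ∈ m

/-- Wait until time `l`, then copy `B_k` forever. -/
theorem Tracks.wait_follow {x : Run A B sat n} (hx : uncondFair A B sat x) {b k : Fin n}
    (hk : k ≠ b) (l : ℕ) :
    Tracks x b (fun t => (x.s (max t l)).2 k) (fun t => (x.e (max t l)).2 k)
      {t | l ≤ t ∧ x.mv t = some k} where
  move t ht := by
    obtain ⟨h1, h2⟩ := ht
    exact ⟨k, hk, h2, by simp [h1], by simp [h1], by simp [Nat.le_succ_of_le h1]⟩
  rest t ht := by
    by_cases h1 : l ≤ t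
    · have h2 : x.mv t ≠ some k := fun h => ht ⟨h1, h⟩
      simp [h1, Nat.le_succ_of_le h1, x.state_succ_of_ne h2, x.input_succ_of_ne h2]
    · have : max (t + 1) l = max t l := by omega
      simp [this]
  fair T := by
    obtain ⟨t, ht, h⟩ := hx (some k) (max T l)
    exact ⟨t, le_of_max_le_left ht, le_of_max_le_right ht, h⟩

theorem Tracks.follow {x : Run A B sat n} (hx : uncondFair A B sat x) {b k : Fin n}
    (hk : k ≠ b) :
    Tracks x b (fun t => (x.s t).2 k) (fun t => (x.e t).2 k) {t | x.mv t = some k} := by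
  simpa using Tracks.wait_follow hx hk 0

/-- Two tracking paths can be glued at a moment where they agree and the first one arrives. -/
theorem Tracks.splice {x : Run A B sat n} {b : Fin n} {st st' : ℕ → QB} {i i' : ℕ → SB}
    {m m' : Set ℕ} (h : Tracks x b st i m) (h' : Tracks x b st' i' m') {a : ℕ}
    (ha : st a = st' a) (hm : ∀ u, u + 1 = a → u ∈ m) :
    Tracks x b (fun t => if t < a then st t else st' t) (fun t => if t < a then i t else i' t)
      {t | t < a ∧ t ∈ m ∨ a ≤ t ∧ t ∈ m'} where
  move t ht := by
    rcases ht with ⟨h1, h2⟩ | ⟨h1, h2⟩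
    · obtain ⟨k, hk, e1, e2, e3, e4⟩ := h.move t h2
      refine ⟨k, hk, e1, by simpa [h1] using e2, by simpa [h1] using e3, ?_⟩
      by_cases h3 : t + 1 < a
      · simpa [h3] using e4
      · have : t + 1 = a := by omega
        simp only [h3, if_false]
        rw [← e4, this, ha]
    · obtain ⟨k, hk, e1, e2, e3, e4⟩ := h'.move t h2
      have h3 : ¬ t < a := by omega
      have h4 : ¬ t + 1 < a := by omega
      exact ⟨k, hk, e1, by simpa [h3] using e2, by simpa [h3] using e3, by simpa [h4] using e4⟩
  rest t ht := by
    by_cases h1 : t < a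
    · have h2 : t ∉ m := fun h => ht (Or.inl ⟨h1, h⟩)
      have h3 : t + 1 < a := by
        by_contra h3
        exact h2 (hm t (by omega))
      simpa [h1, h3] using h.rest t h2
    · have h2 : t ∉ m' := fun h => ht (Or.inr ⟨not_lt.1 h1, h⟩)
      have h4 : ¬ t + 1 < a := by omega
      simpa [h1, h4] using h'.rest t h2
  fair T := by
    obtain ⟨t, ht, h⟩ := h'.fair (max T a)
    exact ⟨t, le_of_max_le_left ht, Or.inr ⟨le_of_max_le_right ht, h⟩⟩

/-- A path that stays in `q`, except for copying the loop of `B_{k j}` from `q` to `q` during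
`[d j, a j)`, for every `j`. -/
theorem exists_tracks_loops {x : Run A B sat n} {b : Fin n} {q : QB} {k : ℕ → Fin n}
    {d a : ℕ → ℕ} (hk : ∀ j, k j ≠ b) (hda : ∀ j, d j < a j) (had : ∀ j, a j ≤ d (j + 1))
    (hd : ∀ j, (x.s (d j)).2 (k j) = q) (ha : ∀ j, (x.s (a j)).2 (k j) = q)
    (hmv : ∀ j, x.mv (a j - 1) = some (k j)) :
    ∃ st i m, Tracks x b st i m ∧
      ∀ t, (∀ j, ¬ (d j ≤ t ∧ t < a j)) → st t = q ∧ t ∉ m := by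
  classical
  have hmono : StrictMono a := strictMono_nat_of_lt_succ fun j => (had j).trans_lt (hda (j + 1))
  have hex : ∀ t, ∃ j, t < a j := fun t => ⟨t + 1, (Nat.lt_succ_self t).trans_le (hmono.id_le _)⟩
  let f : ℕ → ℕ := fun t => Nat.find (hex t)
  have hlt : ∀ t, t < a (f t) := fun t => Nat.find_spec (hex t)
  have hf : ∀ t j, t < a j → (∀ l < j, a l ≤ t) → f t = j := fun t j h1 h2 =>
    (Nat.find_eq_iff _).2 ⟨h1, fun l hl => not_lt.2 (h2 l hl)⟩
  have hmin : ∀ t, ∀ l < f t, a l ≤ t := fun t l hl => not_lt.1 (Nat.find_min (hex t) hl)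
  have hstep : ∀ t, t + 1 < a (f t) → f (t + 1) = f t := fun t h =>
    hf _ _ h fun l hl => (hmin t l hl).trans t.le_succ
  have hjump : ∀ t, t + 1 = a (f t) → f (t + 1) = f t + 1 := fun t h =>
    hf _ _ (h ▸ hmono (Nat.lt_succ_self _)) fun l hl => h ▸ hmono.monotone (Nat.lt_succ_iff.1 hl)
  refine ⟨fun t => (x.s (max t (d (f t)))).2 (k (f t)), fun t => (x.e (max t (d (f t)))).2 (k (f t)),
    {t | d (f t) ≤ t ∧ x.mv t = some (k (f t))}, ⟨?_, ?_, ?_⟩, ?_⟩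
  · rintro t ⟨h1, h2⟩
    refine ⟨k (f t), hk _, h2, by simp [h1], by simp [h1], ?_⟩
    rcases (Nat.succ_le_of_lt (hlt t)).lt_or_eq with h3 | h3
    · simp [hstep t h3, Nat.le_succ_of_le h1]
    · have h4 : a (f t) ≤ d (f t + 1) := had _
      have h5 : max (t + 1) (d (f t + 1)) = d (f t + 1) := by omega
      simp only [hjump t h3, h5, hd]
      rw [show t + 1 = a (f t) from h3, ha]
  · intro t ht
    have h3 : t + 1 < a (f t) := by
      refine (Nat.succ_le_of_lt (hlt t)).lt_of_ne fun h3 => ht ⟨?_, ?_⟩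
      · have := hda (f t)
        omega
      · rw [← hmv (f t), ← h3]; rfl
    simp only [hstep t h3]
    by_cases h1 : d (f t) ≤ t
    · have h2 : x.mv t ≠ some (k (f t)) := fun h => ht ⟨h1, h⟩
      simp [h1, Nat.le_succ_of_le h1, x.state_succ_of_ne h2, x.input_succ_of_ne h2]
    · have : max (t + 1) (d (f t)) = max t (d (f t)) := by omega
      simp [this]
  · intro T
    have h0 : T ≤ a T := hmono.id_le T
    have h1 : a T < a (T + 1) := hmono (Nat.lt_succ_self T)
    have h2 : f (a (T + 1) - 1) = T + 1 := hf _ _ (by omega) fun l hl => by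
      have := hmono.monotone (Nat.lt_succ_iff.1 hl)
      omega
    refine ⟨a (T + 1) - 1, by omega, ?_, ?_⟩
    · have := hda (T + 1)
      rw [h2]; omega
    · rw [h2]; exact hmv _
  · intro t ht
    have h1 : t < d (f t) := by
      by_contra h
      exact ht (f t) ⟨not_lt.1 h, hlt t⟩
    refine ⟨?_, fun h => absurd h.1 (not_le.2 h1)⟩
    simp only [max_eq_right h1.le, hd]

/-- Some `B`-process other than `B_b` is in state `q` at time `t`. -/
def Run.Occupied (x : Run A B sat n) (b : Fin n) (q : QB) (t : ℕ) : Prop :=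
  ∃ k ≠ b, (x.s t).2 k = q

theorem Run.exists_first_occupied {x : Run A B sat n} {b : Fin n} {q : QB}
    (h : ∃ t, x.Occupied b q t) :
    ∃ t, ∃ k ≠ b, (x.s t).2 k = q ∧ (∀ u < t, ¬ x.Occupied b q u) ∧
      ∀ u, u + 1 = t → x.mv u = some k := by
  classical
  obtain ⟨k, hk, hq⟩ := Nat.find_spec h
  refine ⟨Nat.find h, k, hk, hq, fun u hu => Nat.find_min h hu, fun u hu => ?_⟩
  by_contra hmv
  refine Nat.find_min h (m := u) (by omega) ⟨k, hk, ?_⟩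
  rw [← x.state_succ_of_ne hmv, hu, hq]

/-- A path that reaches `q` as soon as possible and then agrees with a given path. -/
theorem exists_tracks_of_first_occupied {x : Run A B sat n} (hx : uncondFair A B sat x)
    {b : Fin n} {q : QB} {st : ℕ → QB} {i : ℕ → SB} {m : Set ℕ} (h : Tracks x b st i m) {a : ℕ}
    {k : Fin n} (hk : k ≠ b) (ha : (x.s a).2 k = q) (hmv : ∀ u, u + 1 = a → x.mv u = some k)
    (hst : st a = q) :
    ∃ st' i' m', Tracks x b st' i' m' ∧ st' 0 = B.init ∧
      ∀ t ≥ a, st' t = st t ∧ (t ∈ m' ↔ t ∈ m) := by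
  refine ⟨_, _, _, (Tracks.follow hx hk).splice h (ha.trans hst.symm) hmv, ?_, fun t ht => ?_⟩
  · have h0 : (x.s 0).2 k = B.init := x.isInit0.2 k
    by_cases h1 : 0 < a
    · simpa [h1] using h0
    · obtain rfl : a = 0 := by omega
      simp [hst, ← ha, h0]
  · have : ¬ t < a := not_lt.2 ht
    simp [this, ht]

/-- If `q` is occupied only finitely often, it can be occupied by a single tracking path for as
long as it is occupied at all. -/
theorem exists_tracks_of_eventually_not_occupied {x : Run A B sat n} (hx : uncondFair A B sat x)
    {b : Fin n} {q : QB} (h : ∃ t, x.Occupied b q t)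
    (hfin : ∃ T, ∀ t ≥ T, ¬ x.Occupied b q t) :
    ∃ st i m, Tracks x b st i m ∧ st 0 = B.init ∧
      ∀ t, x.Occupied b q t → x.Occupied b q (t + 1) → st t = q ∧ t ∉ m := by
  classical
  obtain ⟨a, k, hk, ha, hmin, hmv⟩ := Run.exists_first_occupied h
  have hT : Nat.find hfin ≠ 0 := fun h0 =>
    Nat.find_spec hfin a (by omega) ⟨k, hk, ha⟩
  obtain ⟨l, hl⟩ := Nat.exists_eq_succ_of_ne_zero hT
  have hlast : ∀ t, x.Occupied b q t → t ≤ l := fun t ht => by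
    by_contra hlt
    exact Nat.find_spec hfin t (by omega) ht
  have hocc : x.Occupied b q l := by
    by_contra hno
    refine Nat.find_min hfin (m := l) (by omega) fun t ht h' => ?_
    have := hlast t h'
    exact hno ((show t = l by omega) ▸ h')
  obtain ⟨k', hk', hl'⟩ := hocc
  have hal : a ≤ l := hlast a ⟨k, hk, ha⟩
  obtain ⟨st, i, m, htr, h0, hag⟩ := exists_tracks_of_first_occupied hx
    (Tracks.wait_follow hx hk' l) hk ha hmv (by simpa [hal] using hl')
  refine ⟨st, i, m, htr, h0, fun t h1 h2 => ?_⟩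
  have h3 := hlast _ h2
  have h4 : a ≤ t := not_lt.1 fun h => hmin t h h1
  obtain ⟨h5, h6⟩ := hag t h4
  rw [h5, h6]
  refine ⟨?_, fun h => ?_⟩
  · simpa [show t ≤ l by omega] using hl'
  · have := h.1
    omega

/-- A process that is infinitely often in `q` eventually makes a loop from `q` to `q`. -/
theorem Run.exists_loop {x : Run A B sat n} (hx : uncondFair A B sat x) {q : QB} {k : Fin n}
    (h : ∀ T, ∃ t ≥ T, (x.s t).2 k = q) (T : ℕ) :
    ∃ d a, T ≤ d ∧ d < a ∧ (x.s d).2 k = q ∧ (x.s a).2 k = q ∧ x.mv (a - 1) = some k := by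
  classical
  obtain ⟨d, hd, hdq⟩ := h T
  obtain ⟨d', hd', hmv⟩ := hx (some k) d
  have hex : ∃ a, d' < a ∧ (x.s a).2 k = q := by
    obtain ⟨a, h1, h2⟩ := h (d' + 1)
    exact ⟨a, h1, h2⟩
  obtain ⟨h1, h2⟩ := Nat.find_spec hex
  refine ⟨d, Nat.find hex, hd, by omega, hdq, h2, ?_⟩
  by_contra hne
  have h3 := x.state_succ_of_ne hne
  rw [Nat.sub_add_cancel (by omega), h2] at h3
  by_cases h4 : Nat.find hex - 1 = d'
  · exact hne (h4.symm ▸ hmv)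
  · exact Nat.find_min hex (m := Nat.find hex - 1) (by omega) ⟨by omega, h3.symm⟩

/-- A division of time into epochs such that every state that is infinitely often occupied is
first occupied before the first epoch and has a loop in every epoch. -/
theorem Run.exists_epochs [Finite QB] {x : Run A B sat n} (hx : uncondFair A B sat x)
    (b : Fin n) :
    ∃ T : ℕ → ℕ, StrictMono T ∧ ∀ q, (∀ u, ∃ t ≥ u, x.Occupied b q t) →
      (∃ t < T 0, x.Occupied b q t) ∧ ∀ j, ∃ k ≠ b, ∃ d a, T j ≤ d ∧ d < a ∧ a ≤ T (j + 1) ∧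
        (x.s d).2 k = q ∧ (x.s a).2 k = q ∧ x.mv (a - 1) = some k := by
  have hpig : ∀ q, (∀ u, ∃ t ≥ u, x.Occupied b q t) →
      ∃ k ≠ b, ∀ u, ∃ t ≥ u, (x.s t).2 k = q := by
    intro q hq
    by_contra! hno
    have h1 : ∀ k : Fin n, ∀ᶠ t in Filter.atTop, k ≠ b → (x.s t).2 k ≠ q := by
      intro k
      by_cases hk : k = b
      · simp [hk]
      · obtain ⟨u, hu⟩ := hno k hk
        exact Filter.eventually_atTop.2 ⟨u, fun t ht _ => hu t ht⟩
    obtain ⟨u, hu⟩ := Filter.eventually_atTop.1 (Filter.eventually_all.2 h1)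
    obtain ⟨t, ht, k, hk, h'⟩ := hq u
    exact hu t ht k hk h'
  have hstart : ∀ q, ∀ᶠ T in Filter.atTop, (∀ u, ∃ t ≥ u, x.Occupied b q t) →
      ∃ t < T, x.Occupied b q t := by
    intro q
    by_cases hq : ∃ t, x.Occupied b q t
    · obtain ⟨t, ht⟩ := hq
      exact Filter.eventually_atTop.2 ⟨t + 1, fun T hT _ => ⟨t, hT, ht⟩⟩
    · refine Filter.Eventually.of_forall fun T h => ?_
      obtain ⟨t, -, ht⟩ := h 0
      exact absurd ⟨t, ht⟩ hq
  have hnext : ∀ T q, ∀ᶠ T' in Filter.atTop, (∀ u, ∃ t ≥ u, x.Occupied b q t) →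
      ∃ k ≠ b, ∃ d a, T ≤ d ∧ d < a ∧ a ≤ T' ∧
        (x.s d).2 k = q ∧ (x.s a).2 k = q ∧ x.mv (a - 1) = some k := by
    intro T q
    by_cases hq : ∀ u, ∃ t ≥ u, x.Occupied b q t
    · obtain ⟨k, hk, h'⟩ := hpig q hq
      obtain ⟨d, a, h1, h2, h3, h4, h5⟩ := Run.exists_loop hx h' T
      exact Filter.eventually_atTop.2 ⟨a, fun T' hT' _ => ⟨k, hk, d, a, h1, h2, hT', h3, h4, h5⟩⟩
    · exact Filter.Eventually.of_forall fun T' h => absurd h hq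
  obtain ⟨T0, hT0⟩ := (Filter.eventually_all.2 hstart).exists
  have hnext' : ∀ T, ∃ T', T < T' ∧ ∀ q, (∀ u, ∃ t ≥ u, x.Occupied b q t) →
      ∃ k ≠ b, ∃ d a, T ≤ d ∧ d < a ∧ a ≤ T' ∧
        (x.s d).2 k = q ∧ (x.s a).2 k = q ∧ x.mv (a - 1) = some k := fun T =>
    ((Filter.eventually_gt_atTop T).and (Filter.eventually_all.2 (hnext T))).exists
  choose F hF1 hF2 using hnext'
  refine ⟨fun j => F^[j] T0, strictMono_nat_of_lt_succ fun j => ?_, fun q hq => ⟨hT0 q hq, fun j => ?_⟩⟩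
  · rw [Function.iterate_succ_apply']
    exact hF1 _
  · simp only [Function.iterate_succ_apply']
    exact hF2 _ q hq

/-- If `q` has a loop in every epoch, it can be occupied from its first occupation on by a
tracking path that leaves `q` only in the epochs of the parity of `r`. -/
theorem exists_tracks_of_epochs {x : Run A B sat n} (hx : uncondFair A B sat x) {b : Fin n}
    {q : QB} {T : ℕ → ℕ} (hT : StrictMono T) (h0 : ∃ t < T 0, x.Occupied b q t)
    (hloop : ∀ j, ∃ k ≠ b, ∃ d a, T j ≤ d ∧ d < a ∧ a ≤ T (j + 1) ∧
        (x.s d).2 k = q ∧ (x.s a).2 k = q ∧ x.mv (a - 1) = some k) (r : ℕ) :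
    ∃ st i m, Tracks x b st i m ∧ st 0 = B.init ∧ ∀ t, x.Occupied b q t ∨ T 0 ≤ t →
      (∀ j, ¬ (T (2 * j + r) ≤ t ∧ t < T (2 * j + r + 1))) → st t = q ∧ t ∉ m := by
  choose k hk d a h1 h2 h3 h4 h5 h6 using hloop
  obtain ⟨st, i, m, htr, hst⟩ := exists_tracks_loops (x := x) (b := b) (q := q)
    (k := fun j => k (2 * j + r)) (d := fun j => d (2 * j + r)) (a := fun j => a (2 * j + r))
    (fun j => hk _) (fun j => h2 _)
    (fun j => (h3 _).trans ((hT.monotone (by omega)).trans (h1 _)))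
    (fun j => h4 _) (fun j => h5 _) (fun j => h6 _)
  obtain ⟨t0, ht0, hocc⟩ := h0
  obtain ⟨u, l, hl, hu, hmin, hmv⟩ := Run.exists_first_occupied ⟨t0, hocc⟩
  have hut : u < T 0 := (not_lt.1 fun h => hmin t0 h hocc).trans_lt ht0
  have hstu : st u = q := (hst u fun j hj => by
    have := hT.monotone (Nat.zero_le (2 * j + r))
    have := h1 (2 * j + r)
    omega).1
  obtain ⟨st', i', m', htr', hi', hag⟩ :=
    exists_tracks_of_first_occupied hx htr hl hu hmv hstu
  refine ⟨st', i', m', htr', hi', fun t ht hj => ?_⟩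
  have hle : u ≤ t := by
    rcases ht with ht | ht
    · exact not_lt.1 fun h => hmin t h ht
    · exact hut.le.trans ht
  obtain ⟨e1, e2⟩ := hag t hle
  rw [e1, e2]
  exact hst t fun j ⟨h7, h8⟩ => hj j ⟨(h1 _).trans h7, h8.trans_le (h3 _)⟩

end Tracking

section Workers

variable {n : ℕ} {A : Template QA SA (Set (QA ⊕ QB))} {B : Template QB SB (Set (QA ⊕ QB))}

/-- There is a family of tracking paths, one for each state of `B` and one for each nontrivial
guard, that witness at rest every nontrivial guard witnessed by some `B`-process at rest. -/
theorem exists_workers [Finite QB] {x : Run A B disjSat n} (hx : uncondFair A B disjSat x)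
    {b k : Fin n} (hk : k ≠ b) (G : Set (Set (QA ⊕ QB))) :
    ∃ (st : QB ⊕ G → ℕ → QB) (i : QB ⊕ G → ℕ → SB) (m : QB ⊕ G → Set ℕ),
      (∀ w, Tracks x b (st w) (i w) (m w) ∧ st w 0 = B.init) ∧
      ∀ t q, x.Occupied b q t → x.Occupied b q (t + 1) → ∀ g ∈ G, Sum.inr q ∈ g →
        ∃ w, Sum.inr (st w t) ∈ g ∧ t ∉ m w := by
  obtain ⟨T, hT, hep⟩ := x.exists_epochs hx b
  have hdefault : ∃ st i m, Tracks x b st i m ∧ st 0 = B.init :=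
    ⟨_, _, _, Tracks.follow hx hk, x.isInit0.2 k⟩
  have hstate : ∀ q, ∃ st i m, (Tracks x b st i m ∧ st 0 = B.init) ∧
      ∀ t, x.Occupied b q t → x.Occupied b q (t + 1) →
        (∀ j, (∀ u, ∃ t ≥ u, x.Occupied b q t) → ¬ (T (2 * j) ≤ t ∧ t < T (2 * j + 1))) →
        st t = q ∧ t ∉ m := by
    intro q
    by_cases hq : ∃ t, x.Occupied b q t
    · by_cases hinf : ∀ u, ∃ t ≥ u, x.Occupied b q t
      · obtain ⟨st, i, m, htr, h0, hst⟩ :=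
          exists_tracks_of_epochs hx hT (hep q hinf).1 (hep q hinf).2 0
        exact ⟨st, i, m, ⟨htr, h0⟩, fun t ht _ hj => hst t (.inl ht) fun j => hj j hinf⟩
      · push Not at hinf
        obtain ⟨st, i, m, htr, h0, hst⟩ := exists_tracks_of_eventually_not_occupied hx hq hinf
        exact ⟨st, i, m, ⟨htr, h0⟩, fun t h1 h2 _ => hst t h1 h2⟩
    · obtain ⟨st, i, m, h⟩ := hdefault
      exact ⟨st, i, m, h, fun t ht => absurd ⟨t, ht⟩ hq⟩
  have hguard : ∀ g : G, ∃ st i m, (Tracks x b st i m ∧ st 0 = B.init) ∧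
      ((∃ q, (∀ u, ∃ t ≥ u, x.Occupied b q t) ∧ Sum.inr q ∈ g.1) →
        ∀ t j, T (2 * j) ≤ t ∧ t < T (2 * j + 1) → Sum.inr (st t) ∈ g.1 ∧ t ∉ m) := by
    intro g
    by_cases hg : ∃ q, (∀ u, ∃ t ≥ u, x.Occupied b q t) ∧ Sum.inr q ∈ g.1
    · obtain ⟨q, hinf, hqg⟩ := hg
      obtain ⟨st, i, m, htr, h0, hst⟩ :=
        exists_tracks_of_epochs hx hT (hep q hinf).1 (hep q hinf).2 1
      refine ⟨st, i, m, ⟨htr, h0⟩, fun _ t j hj => ?_⟩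
      obtain ⟨h1, h2⟩ := hst t (.inr ((hT.monotone (Nat.zero_le _)).trans hj.1)) fun j' hj' => by
        have h1 := hT.lt_iff_lt.1 (hj.1.trans_lt hj'.2)
        have h2 := hT.lt_iff_lt.1 (hj'.1.trans_lt hj.2)
        omega
      exact ⟨h1 ▸ hqg, h2⟩
    · obtain ⟨st, i, m, h⟩ := hdefault
      exact ⟨st, i, m, h, fun h => absurd h hg⟩
  choose st₁ i₁ m₁ h₁ h₁' using hstate
  choose st₂ i₂ m₂ h₂ h₂' using hguard
  refine ⟨Sum.elim st₁ st₂, Sum.elim i₁ i₂, Sum.elim m₁ m₂, by rintro (q | g) <;> simp [h₁, h₂],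
    fun t q ht ht' g hg hqg => ?_⟩
  by_cases hex : ∃ j, (∀ u, ∃ t ≥ u, x.Occupied b q t) ∧ T (2 * j) ≤ t ∧ t < T (2 * j + 1)
  · obtain ⟨j, hinf, hj⟩ := hex
    exact ⟨Sum.inr ⟨g, hg⟩, h₂' ⟨g, hg⟩ ⟨q, hinf, hqg⟩ t j hj⟩
  · obtain ⟨h3, h4⟩ := h₁' q t ht ht' fun j hinf hj => hex ⟨j, hinf, hj⟩
    exact ⟨Sum.inl q, by simpa [h3] using hqg, h4⟩

theorem mem_guardsOf_of_jointTrans {q q' : QA ⊕ QB} {a : SA ⊕ SB} {g : Set (QA ⊕ QB)}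
    (h : jointTrans A B q a g q') : g ∈ guardsOf A ∪ guardsOf B := by
  rcases q with q | q <;> rcases a with a | a <;> rcases q' with q' | q' <;>
    simp only [jointTrans] at h
  · exact Or.inl ⟨_, _, _, h⟩
  · exact Or.inr ⟨_, _, _, h⟩

/-- A fair run can be simulated by any number of `B`-processes that suffices for the workers. -/
theorem exists_run_of_workers [Finite QB] {x : Run A B disjSat n} (hx : uncondFair A B disjSat x)
    {b k : Fin n} (hk : k ≠ b) {N : ℕ} (φ : Fin N ≃ QB ⊕ ↑(ntGuards A ∪ ntGuards B))
    (h : LTL (AtomK QA SA QB SB 1)) :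
    ∃ y : Run A B disjSat (N + 1), uncondFair A B disjSat y ∧
      (LTL.holds (localTrace x.s x.e b) h 0 ↔ LTL.holds (localTrace y.s y.e 0) h 0) := by
  obtain ⟨st, i, m, htr, hcov⟩ := exists_workers hx hk (ntGuards A ∪ ntGuards B)
  let s : ℕ → GState QA QB (N + 1) := fun t =>
    ((x.s t).1, Fin.cons ((x.s t).2 b) fun j => st (φ j) t)
  let e : ℕ → GInput SA SB (N + 1) := fun t =>
    ((x.e t).1, Fin.cons ((x.e t).2 b) fun j => i (φ j) t)
  let C : Proc (N + 1) → Set ℕ := fun p => match p with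
    | none => {t | x.mv t = none}
    | some j => Fin.cases {t | x.mv t = some b} (fun j => m (φ j)) j
  let M : ℕ → Set (Proc (N + 1)) := fun t => {p | t ∈ C p}
  have hwit : ∀ t, ∀ g ∈ guardsOf A ∪ guardsOf B, disjSat (others (x.s t) (x.mv t)) g →
      ∃ p' ∉ M t, view (s t) p' ∈ g := by
    rintro t g hg ⟨-, ⟨p, hp, rfl⟩, hpg⟩
    by_cases huniv : g = Set.univ
    · subst huniv
      by_cases h0 : x.mv t = none
      · exact ⟨some 0, fun h1 : x.mv t = some b => by simp [h0] at h1, trivial⟩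
      · exact ⟨none, h0, trivial⟩
    · rcases p with _ | l
      · exact ⟨none, fun h1 => hp (Eq.symm h1), hpg⟩
      · by_cases hl : l = b
        · subst hl
          exact ⟨some 0, fun h1 => hp (Eq.symm h1), hpg⟩
        · obtain ⟨w, hw, hw'⟩ := hcov t _ ⟨l, hl, rfl⟩
            ⟨l, hl, x.state_succ_of_ne fun h1 => hp h1.symm⟩ g
            (by
              have hne : g ≠ ∅ := Set.nonempty_iff_ne_empty.1 ⟨_, hpg⟩
              rcases hg with hg | hg
              · exact Or.inl ⟨hg, huniv, hne⟩
              · exact Or.inr ⟨hg, huniv, hne⟩) hpg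
          refine ⟨some (φ.symm w).succ, ?_, ?_⟩
          · simpa [M, C] using hw'
          · simpa [s, view] using hw
  have hcopy : ∀ t, ∀ p ∈ M t, view (s t) p = view (x.s t) (x.mv t) ∧
      inp (e t) p = inp (x.e t) (x.mv t) ∧
      view (s (t + 1)) p = view (x.s (t + 1)) (x.mv t) := by
    rintro t (_ | j) hp
    · have h1 : x.mv t = none := hp
      rw [h1]
      exact ⟨rfl, rfl, rfl⟩
    · cases j using Fin.cases with
      | zero =>
        have h1 : x.mv t = some b := hp
        rw [h1]
        exact ⟨rfl, rfl, rfl⟩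
      | succ j =>
        obtain ⟨l, -, h1, h2, h3, h4⟩ := (htr (φ j)).1.move t hp
        rw [h1]
        simp [s, e, view, inp, h2, h3, h4]
  obtain ⟨y, hy, hiff⟩ := exists_run_of_simultaneous (A := A) (B := B) s e M 0
    ⟨x.isInit0.1, fun j => by
      cases j using Fin.cases with
      | zero => exact x.isInit0.2 b
      | succ j => exact (htr (φ j)).2⟩
    (by
      intro t p hp
      obtain ⟨h1, h2, h3⟩ := hcopy t p hp
      obtain ⟨⟨g, hg, hsat⟩, -⟩ := step_iff.1 (x.steps t)
      exact ⟨g, by rwa [h1, h2, h3], hwit t g (mem_guardsOf_of_jointTrans hg) hsat⟩)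
    (by
      rintro t (_ | j) hp
      · have h1 : none ≠ x.mv t := fun h1 => hp h1.symm
        exact ⟨x.view_succ_of_ne h1, x.persist t _ h1⟩
      · cases j using Fin.cases with
        | zero =>
          have h1 : some b ≠ x.mv t := fun h1 => hp h1.symm
          exact ⟨x.view_succ_of_ne h1, x.persist t _ h1⟩
        | succ j =>
          obtain ⟨h1, h2⟩ := (htr (φ j)).1.rest t hp
          simp [s, e, view, inp, h1, h2])
    (by
      intro t (h1 : x.mv t = none) (h2 : x.mv t = some b)
      simp [h1] at h2)
    (by
      rintro (_ | j) T
      · exact hx none T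
      · cases j using Fin.cases with
        | zero => exact hx (some b) T
        | succ j => exact (htr (φ j)).1.fair T) h
  exact ⟨y, hy, hiff⟩

end Workers

/-- **Bounding Lemma (LTL\X, disjunctive, fair).**
For `n ≥ |B| + |G| + 1`: if some unconditionally-fair run of `(A,B)^{(1,n)}` satisfies the
`1`-indexed `LTL\X` formula `h(A,B^{(1)})`, then some unconditionally-fair run of
`(A,B)^{(1,|B|+|G|+1)}` satisfies it. -/
theorem disjunctive_bounding_ltl_fair
    (QA QB SA SB : Type) [Fintype QA] [Fintype QB] [Fintype SA] [Fintype SB]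
    (A : Template QA SA (Set (QA ⊕ QB))) (B : Template QB SB (Set (QA ⊕ QB)))
    (h : LTL (AtomK QA SA QB SB 1)) (n : ℕ)
    (hn : Fintype.card QB + numG A B + 1 ≤ n)
    (hx : ∃ x : Run A B disjSat n, uncondFair A B disjSat x ∧
      LTL.holds (traceK A B disjSat x (fun _ => (⟨0, by omega⟩ : Fin n))) h 0) :
    ∃ x : Run A B disjSat (Fintype.card QB + numG A B + 1), uncondFair A B disjSat x ∧
      LTL.holds (traceK A B disjSat x
        (fun _ => (⟨0, by omega⟩ : Fin (Fintype.card QB + numG A B + 1)))) h 0 := by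
  obtain ⟨x, hxf, hxh⟩ := hx
  have hB : 0 < Fintype.card QB := Fintype.card_pos_iff.2 ⟨B.init⟩
  have hcard : Nat.card (QB ⊕ ↑(ntGuards A ∪ ntGuards B)) = Fintype.card QB + numG A B := by
    rw [Nat.card_sum, Nat.card_eq_fintype_card, Nat.card_coe_set_eq, numG]
  obtain ⟨y, hyf, hy⟩ := exists_run_of_workers hxf (b := ⟨0, by omega⟩) (k := ⟨1, by omega⟩)
    (by simp) (Finite.equivFinOfCardEq hcard).symm h
  refine ⟨y, hyf, ?_⟩
  rw [traceK_eq_localTrace] at hxh ⊢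
  exact hy.1 hxh
end GP
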